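/- arXiv:1107.1878 — 3 statements merged into one kernel-verified Lean document; each statement's English description precedes it below -/
import Mathlib

section
/- For every polyomino A there exists k ≥ 1 such that τ(A)(n) is finite for all n with 1 ≤ n < k, and τ(A)(n) = ∞ for all n ≥ k. -/
/-- Cells of the square board. -/
abbrev Cell : Type := ℤ × ℤ

/-- Two cells are adjacent if they differ by `(±1,0)` or `(0,±1)`. -/
def Adjacent (p q : Cell) : Prop :=
  (p.1 - q.1).natAbs + (p.2 - q.2).natAbs = 1

/-- A polyomino is a finite nonempty set of cells that is connected under adjacency. -/
def IsPolyomino (A : Finset Cell) : Prop :=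
  A.Nonempty ∧ ∀ p ∈ A, ∀ q ∈ A,
    Relation.ReflTransGen (fun u v => u ∈ A ∧ v ∈ A ∧ Adjacent u v) p q

/-- A symmetry of the square lattice: a translation composed with a rotation by a
multiple of 90 degrees and possibly a reflection. -/
def IsSquareSymmetry (f : Cell → Cell) : Prop :=
  ∃ (e₁ e₂ : ℤ) (s : Bool) (t : Cell),
    (e₁ = 1 ∨ e₁ = -1) ∧ (e₂ = 1 ∨ e₂ = -1) ∧
    ∀ p : Cell, f p =
      if s then (e₁ * p.2 + t.1, e₂ * p.1 + t.2)
      else (e₁ * p.1 + t.1, e₂ * p.2 + t.2)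

/-- `P` is a placement of the polyomino `A`: the image of `A` under a symmetry
of the square lattice. -/
def IsPlacement (A : Finset Cell) (P : Set Cell) : Prop :=
  ∃ f : Cell → Cell, IsSquareSymmetry f ∧ P = f '' (↑A : Set Cell)

/-- The maker's move on his `n`-th turn (`0`-indexed), given his strategy `σ`
(a function of the list of the breaker's previous moves, which together with `σ`
determines the whole history) and the breaker's sequence of moves `β`. -/
def makerMove (σ : List (Finset Cell) → Finset Cell) (β : ℕ → Finset Cell) (n : ℕ) :
    Finset Cell :=
  σ ((List.range n).map β)

/-- The set of cells marked by the maker after his first `n` turns. -/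
def makerMarks (σ : List (Finset Cell) → Finset Cell) (β : ℕ → Finset Cell) :
    ℕ → Finset Cell
  | 0 => ∅
  | n + 1 => makerMarks σ β n ∪ makerMove σ β n

/-- The set of cells marked by the breaker after her first `n` turns. -/
def breakerMarks (β : ℕ → Finset Cell) : ℕ → Finset Cell
  | 0 => ∅
  | n + 1 => breakerMarks β n ∪ β n

/-- The maker plays legally: on every turn he marks exactly `a` previously unmarked cells. -/
def MakerLegal (a : ℕ) (σ : List (Finset Cell) → Finset Cell) (β : ℕ → Finset Cell) : Prop :=
  ∀ n, (makerMove σ β n).card = a ∧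
    Disjoint (makerMove σ β n) (makerMarks σ β n ∪ breakerMarks β n)

/-- The breaker plays legally: on every turn she marks exactly `b` previously unmarked
cells (on turn `n` she moves after the maker, so she must avoid `makerMarks σ β (n+1)`). -/
def BreakerLegal (b : ℕ) (σ : List (Finset Cell) → Finset Cell) (β : ℕ → Finset Cell) : Prop :=
  ∀ n, (β n).card = b ∧ Disjoint (β n) (makerMarks σ β (n + 1) ∪ breakerMarks β n)

/-- `A` is an `(a,b)`-winner: the maker has a winning strategy in the weak `(a,b)`
achievement game with goal `A`, i.e. a strategy that always plays legally against any
legal breaker play and eventually marks all cells of some placement of `A`. -/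
def IsWinner (A : Finset Cell) (a b : ℕ) : Prop :=
  ∃ σ : List (Finset Cell) → Finset Cell, ∀ β : ℕ → Finset Cell,
    BreakerLegal b σ β →
      MakerLegal a σ β ∧
        ∃ n, ∃ P : Set Cell, IsPlacement A P ∧ P ⊆ ↑(makerMarks σ β n)

/-- The threshold sequence of `A`: `tau A n` is the supremum in `ℕ∞` of the set of
`b ∈ ℕ` such that `A` is an `(n,b)`-winner (so it is `∞` when `A` is an `(n,b)`-winner
for every `b`). -/
noncomputable def tau (A : Finset Cell) (n : ℕ) : ℕ∞ :=
  ⨆ (b : ℕ) (_ : IsWinner A n b), (b : ℕ∞)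

theorem exists_fill (m : ℕ) (U X : Finset Cell) (hU : U.card ≤ m) :
    ∃ S : Finset Cell, S.card = m ∧ Disjoint S X ∧ U \ X ⊆ S := by
  obtain ⟨S, hS, hc⟩ := Infinite.exists_superset_card_eq (U ∪ X) (m + X.card)
    ((Finset.card_union_le U X).trans (by omega))
  refine ⟨S \ X, ?_, Finset.sdiff_disjoint, ?_⟩
  · rw [Finset.card_sdiff_of_subset (Finset.subset_union_right.trans hS)]
    omega
  · exact Finset.sdiff_subset_sdiff (Finset.subset_union_left.trans hS) (le_refl _)

open Classical in
/-- A set of `m` fresh cells avoiding `X` and containing `U \ X`. -/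
noncomputable def fill (m : ℕ) (U X : Finset Cell) : Finset Cell :=
  if h : U.card ≤ m then (exists_fill m U X h).choose else ∅

theorem fill_spec (m : ℕ) (U X : Finset Cell) (h : U.card ≤ m) :
    (fill m U X).card = m ∧ Disjoint (fill m U X) X ∧ U \ X ⊆ fill m U X := by
  unfold fill
  rw [dif_pos h]
  exact (exists_fill m U X h).choose_spec

/-- Union of the breaker moves of a reversed history. -/
def histMarks : List (Finset Cell) → Finset Cell
  | [] => ∅
  | b :: r => histMarks r ∪ b

/-- Cells of the maker (following the filled strategy) after a reversed history. -/
noncomputable def ownMarks (m : ℕ) (T : List (Finset Cell) → Finset Cell) :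
    List (Finset Cell) → Finset Cell
  | [] => ∅
  | _ :: r => ownMarks m T r ∪ fill m (T r.reverse) (ownMarks m T r ∪ histMarks r)

/-- The filled strategy. -/
noncomputable def filled (m : ℕ) (T : List (Finset Cell) → Finset Cell)
    (l : List (Finset Cell)) : Finset Cell :=
  fill m (T l) (ownMarks m T l.reverse ∪ histMarks l.reverse)

theorem hist_succ (β : ℕ → Finset Cell) (n : ℕ) :
    ((List.range (n + 1)).map β).reverse = β n :: ((List.range n).map β).reverse := by
  simp [List.range_succ]

theorem histMarks_eq (β : ℕ → Finset Cell) (n : ℕ) :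
    histMarks ((List.range n).map β).reverse = breakerMarks β n := by
  induction n with
  | zero => rfl
  | succ n ih => rw [hist_succ, histMarks, breakerMarks, ih]

theorem ownMarks_eq (m : ℕ) (T : List (Finset Cell) → Finset Cell) (β : ℕ → Finset Cell) (n : ℕ) :
    ownMarks m T ((List.range n).map β).reverse = makerMarks (filled m T) β n := by
  induction n with
  | zero => rfl
  | succ n ih =>
    rw [hist_succ, ownMarks, makerMarks, makerMove, filled, List.reverse_reverse, ih]

theorem filled_move (m : ℕ) (T : List (Finset Cell) → Finset Cell) (β : ℕ → Finset Cell) (n : ℕ) :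
    makerMove (filled m T) β n =
      fill m (makerMove T β n) (makerMarks (filled m T) β n ∪ breakerMarks β n) := by
  rw [← ownMarks_eq, ← histMarks_eq]
  rfl

theorem makerMove_congr (σ : List (Finset Cell) → Finset Cell) {β γ : ℕ → Finset Cell} {n : ℕ}
    (h : ∀ j < n, β j = γ j) : makerMove σ β n = makerMove σ γ n := by
  unfold makerMove
  congr 1
  exact List.map_congr_left fun j hj => h j (List.mem_range.1 hj)

theorem makerMarks_congr (σ : List (Finset Cell) → Finset Cell) {β γ : ℕ → Finset Cell} (n : ℕ)
    (h : ∀ j, j + 1 < n → β j = γ j) : makerMarks σ β n = makerMarks σ γ n := by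
  induction n with
  | zero => rfl
  | succ n ih =>
    rw [makerMarks, makerMarks, ih fun j hj => h j (by omega),
      makerMove_congr σ fun j hj => h j (by omega)]

theorem breakerMarks_congr {β γ : ℕ → Finset Cell} (n : ℕ)
    (h : ∀ j < n, β j = γ j) : breakerMarks β n = breakerMarks γ n := by
  induction n with
  | zero => rfl
  | succ n ih =>
    rw [breakerMarks, breakerMarks, ih fun j hj => h j (by omega), h n (by omega)]

/-- Continue the breaker play `β` legally from turn `n` on. -/
noncomputable def contPlay (b : ℕ) (σ : List (Finset Cell) → Finset Cell) (β : ℕ → Finset Cell)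
    (n : ℕ) (i : ℕ) : Finset Cell :=
  if i < n then β i else
    fill b ∅ (makerMarks σ (fun j => if _h : j < i then contPlay b σ β n j else ∅) (i + 1) ∪
      breakerMarks (fun j => if _h : j < i then contPlay b σ β n j else ∅) i)
termination_by i

theorem contPlay_legal (b : ℕ) (σ : List (Finset Cell) → Finset Cell) (β : ℕ → Finset Cell)
    (n : ℕ) (h : ∀ i < n, (β i).card = b ∧
      Disjoint (β i) (makerMarks σ β (i + 1) ∪ breakerMarks β i)) :
    BreakerLegal b σ (contPlay b σ β n) ∧ ∀ i < n, contPlay b σ β n i = β i := by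
  have hlt : ∀ i < n, contPlay b σ β n i = β i := by
    intro i hi
    rw [contPlay, if_pos hi]
  refine ⟨fun i => ?_, hlt⟩
  by_cases hi : i < n
  · rw [hlt i hi, makerMarks_congr σ (γ := β) (i + 1) fun j hj => hlt j (by omega),
      breakerMarks_congr (γ := β) i fun j hj => hlt j (by omega)]
    exact h i hi
  · have e1 := makerMarks_congr σ (β := fun j => if _h : j < i then contPlay b σ β n j else ∅)
      (γ := contPlay b σ β n) (i + 1) fun j hj => by
        have : j < i := by omega
        simp [this]
    have e2 := breakerMarks_congr (β := fun j => if _h : j < i then contPlay b σ β n j else ∅)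
      (γ := contPlay b σ β n) i fun j hj => by simp [hj]
    have e : contPlay b σ β n i = fill b ∅ (makerMarks σ (contPlay b σ β n) (i + 1) ∪
        breakerMarks (contPlay b σ β n) i) := by
      rw [← e1, ← e2]
      conv_lhs => rw [contPlay, if_neg hi]
    have := fill_spec b ∅ (makerMarks σ (contPlay b σ β n) (i + 1) ∪
        breakerMarks (contPlay b σ β n) i) (by simp)
    rw [← e] at this
    exact ⟨this.1, this.2.1⟩

theorem winner_mono (A : Finset Cell) {a a' b : ℕ} (h : a ≤ a') (hw : IsWinner A a b) :
    IsWinner A a' b := by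
  obtain ⟨σ, hσ⟩ := hw
  refine ⟨filled a' σ, fun β hβ => ?_⟩
  have key : ∀ n, ∀ k ≤ n, makerMarks σ β k ⊆ makerMarks (filled a' σ) β k := by
    intro n
    induction n with
    | zero =>
      intro k hk
      obtain rfl : k = 0 := by omega
      exact le_refl _
    | succ n ih =>
      intro k hk
      rcases Nat.lt_or_eq_of_le hk with hk | rfl
      · exact ih k (by omega)
      obtain ⟨hl, he⟩ := contPlay_legal b σ β n fun i hi => ⟨(hβ i).1,
        (hβ i).2.mono_right (Finset.union_subset_union (ih (i + 1) hi) (le_refl _))⟩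
      have hm := (hσ _ hl).1 n
      rw [makerMove_congr σ he, breakerMarks_congr n he] at hm
      have hs := (fill_spec a' (makerMove σ β n)
        (makerMarks (filled a' σ) β n ∪ breakerMarks β n) (hm.1.le.trans h)).2.2
      rw [← filled_move] at hs
      have hd := Finset.disjoint_left.1 hm.2
      intro x hx
      rw [makerMarks, Finset.mem_union] at hx ⊢
      rcases hx with hx | hx
      · exact Or.inl (ih n le_rfl hx)
      · by_cases hx' : x ∈ makerMarks (filled a' σ) β n
        · exact Or.inl hx'
        · refine Or.inr (hs (Finset.mem_sdiff.2 ⟨hx, fun hc => ?_⟩))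
          rcases Finset.mem_union.1 hc with hc | hc
          · exact hx' hc
          · exact hd hx (Finset.mem_union_right _ hc)
  have hL : BreakerLegal b σ β := fun i => ⟨(hβ i).1,
    (hβ i).2.mono_right (Finset.union_subset_union (key _ (i + 1) le_rfl) (le_refl _))⟩
  obtain ⟨hM, n, P, hP, hPs⟩ := hσ β hL
  refine ⟨fun n => ?_, n, P, hP, hPs.trans (Finset.coe_subset.2 (key n n le_rfl))⟩
  rw [filled_move]
  have := fill_spec a' (makerMove σ β n)
    (makerMarks (filled a' σ) β n ∪ breakerMarks β n) ((hM n).1.le.trans h)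
  exact ⟨this.1, this.2.1⟩

theorem winner_big (A : Finset Cell) {a : ℕ} (b : ℕ) (h : A.card ≤ a) : IsWinner A a b := by
  let T : List (Finset Cell) → Finset Cell := fun l => if l = [] then A else ∅
  have hT : ∀ l, (T l).card ≤ a := by
    intro l
    simp only [T]
    split_ifs <;> simp [h]
  refine ⟨filled a T, fun β hβ => ⟨fun n => ?_, 1, ↑A, ⟨id, ⟨1, 1, false, 0, ?_⟩, by simp⟩, ?_⟩⟩
  · rw [filled_move]
    have := fill_spec a (makerMove T β n)
      (makerMarks (filled a T) β n ∪ breakerMarks β n) (hT _)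
    exact ⟨this.1, this.2.1⟩
  · simp
  · have := (fill_spec a (makerMove T β 0)
      (makerMarks (filled a T) β 0 ∪ breakerMarks β 0) (hT _)).2.2
    rw [← filled_move] at this
    simpa [makerMarks, breakerMarks, makerMove, T] using this

theorem tau_mono (A : Finset Cell) {a a' : ℕ} (h : a ≤ a') : tau A a ≤ tau A a' :=
  iSup_mono fun _ => iSup_mono' fun hw => ⟨winner_mono A h hw, le_rfl⟩

theorem tau_big (A : Finset Cell) {a : ℕ} (h : A.card ≤ a) : tau A a = ⊤ := by
  have : ∀ b : ℕ, (b : ℕ∞) ≤ tau A a := fun b =>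
    le_iSup₂_of_le b (winner_big A b h) le_rfl
  exact ENat.eq_top_iff_forall_ge.2 this

/-- For every polyomino `A` there is `k ≥ 1` such that `τ(A)(n)` is finite for
`1 ≤ n < k` and `τ(A)(n) = ∞` for `n ≥ k`. -/
theorem tau_eventually_top (A : Finset Cell) (hA : IsPolyomino A) :
    ∃ k : ℕ, 1 ≤ k ∧ (∀ n : ℕ, 1 ≤ n → n < k → tau A n ≠ ⊤) ∧
      ∀ n : ℕ, k ≤ n → tau A n = ⊤ := by
  classical
  have hex : ∃ k : ℕ, 1 ≤ k ∧ tau A k = ⊤ :=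
    ⟨A.card, hA.1.card_pos, tau_big A le_rfl⟩
  refine ⟨Nat.find hex, (Nat.find_spec hex).1, fun n h1 hn ht => Nat.find_min hex hn ⟨h1, ht⟩,
    fun n hn => top_le_iff.1 ?_⟩
  exact (Nat.find_spec hex).2 ▸ tau_mono A hn
end

section
/- For every polyomino A and every n ≥ 1, τ(A)(n) + 1 ≤ τ(A)(n+1) in ℕ∞; in particular, if τ(A)(n) is finite then τ(A)(n) < τ(A)(n+1). -/
def Win (A : Finset Cell) (a b : ℕ) (W : Set Cell) : ℕ → Finset Cell → Finset Cell → Prop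
  | 0, M, _ => ∃ P : Set Cell, IsPlacement A P ∧ P ⊆ ↑M
  | k + 1, M, B => ∃ X : Finset Cell, (↑X : Set Cell) ⊆ W ∧ X.card ≤ a ∧ Disjoint X B ∧
      ∀ Y : Finset Cell, Y.card ≤ b → Disjoint Y (M ∪ X) → Win A a b W k (M ∪ X) (B ∪ Y)

theorem Win.mono {A : Finset Cell} {a b : ℕ} {W W' : Set Cell} (hW : W ⊆ W') {k : ℕ} :
    ∀ {M M' B B' : Finset Cell}, M ⊆ M' → (∀ x ∈ B', x ∈ W → x ∈ B) →
      Win A a b W k M B → Win A a b W' k M' B' := by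
  induction k with
  | zero =>
    rintro M M' B B' hM hB ⟨P, hP, hPM⟩
    exact ⟨P, hP, hPM.trans (by exact_mod_cast hM)⟩
  | succ k ih =>
    rintro M M' B B' hM hB ⟨X, hXW, hXc, hXB, h⟩
    refine ⟨X, hXW.trans hW, hXc, ?_, ?_⟩
    · rw [Finset.disjoint_left] at hXB ⊢
      intro x hx hx'
      exact hXB hx (hB x hx' (hXW hx))
    · intro Y hY hYd
      refine ih (Finset.union_subset_union_left hM) ?_
        (h Y hY (hYd.mono_right (Finset.union_subset_union_left hM)))
      intro x hx hxW
      rcases Finset.mem_union.1 hx with hx | hx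
      · exact Finset.mem_union_left _ (hB x hx hxW)
      · exact Finset.mem_union_right _ hx

theorem Win.succ {A : Finset Cell} {a b : ℕ} {W : Set Cell} {k : ℕ} :
    ∀ {M B : Finset Cell}, Win A a b W k M B → Win A a b W (k + 1) M B := by
  induction k with
  | zero =>
    rintro M B ⟨P, hP, hPM⟩
    refine ⟨∅, by simp, by simp, by simp, fun Y _ _ => ⟨P, hP, by simpa using hPM⟩⟩
  | succ k ih =>
    rintro M B ⟨X, hXW, hXc, hXB, h⟩
    exact ⟨X, hXW, hXc, hXB, fun Y hY hYd => ih (h Y hY hYd)⟩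

theorem Win.le {A : Finset Cell} {a b : ℕ} {W : Set Cell} {k k' : ℕ} (hk : k ≤ k')
    {M B : Finset Cell} (h : Win A a b W k M B) : Win A a b W k' M B := by
  induction hk with
  | refl => exact h
  | step _ ih => exact ih.succ

/-- uniformity -/
theorem uniform_win {A : Finset Cell} {a c : ℕ} (M : Finset Cell) (b : ℕ) :
    ∀ B : Finset Cell,
    (∀ Y : Finset Cell, Y.card ≤ b → Disjoint Y M →
      ∃ (W : Finset Cell) (k : ℕ), Win A a c ↑W k M (B ∪ Y)) →
    ∃ (W : Finset Cell) (k : ℕ), ∀ Y : Finset Cell, Y.card ≤ b → Disjoint Y M →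
      Win A a c ↑W k M (B ∪ Y) := by
  induction b with
  | zero =>
    intro B h
    obtain ⟨W, k, hw⟩ := h ∅ (by simp) (by simp)
    refine ⟨W, k, fun Y hY _ => ?_⟩
    have : Y = ∅ := by simpa using hY
    rwa [this]
  | succ b ih =>
    intro B h
    obtain ⟨W0, k0, hw0⟩ := h ∅ (by simp) (by simp)
    have key : ∀ x : Cell, ∃ (W : Finset Cell) (k : ℕ), x ∉ M → ∀ Y : Finset Cell, Y.card ≤ b →
        Disjoint Y M → Win A a c ↑W k M ((B ∪ {x}) ∪ Y) := by
      intro x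
      by_cases hx : x ∈ M
      · exact ⟨∅, 0, fun h => absurd hx h⟩
      · obtain ⟨W, k, hw⟩ := ih (B ∪ {x}) (by
          intro Y hY hd
          rw [Finset.union_assoc]
          apply h
          · have := Finset.card_union_le {x} Y
            simp only [Finset.card_singleton] at this
            omega
          · rw [Finset.disjoint_union_left]
            exact ⟨by simpa using hx, hd⟩)
        exact ⟨W, k, fun _ => hw⟩
    choose Wf kf hf using key
    refine ⟨W0 ∪ W0.biUnion Wf, k0 + W0.sup kf, ?_⟩
    intro Y hY hd
    by_cases hYW : ∃ x ∈ Y, x ∈ W0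
    · obtain ⟨x, hxY, hxW⟩ := hYW
      have hxM : x ∉ M := Finset.disjoint_left.1 hd hxY
      have h1 := hf x hxM (Y.erase x) (by rw [Finset.card_erase_of_mem hxY]; omega)
        (hd.mono_left (Finset.erase_subset _ _))
      have h2 : (B ∪ {x}) ∪ Y.erase x = B ∪ Y := by
        rw [Finset.union_assoc]
        congr 1
        rw [← Finset.insert_eq, Finset.insert_erase hxY]
      rw [h2] at h1
      refine Win.mono ?_ (Finset.Subset.refl _) (fun _ h _ => h)
        (h1.le ((Finset.le_sup (f := kf) hxW).trans (Nat.le_add_left _ _)))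
      exact_mod_cast (Finset.subset_biUnion_of_mem Wf hxW).trans Finset.subset_union_right
    · push Not at hYW
      refine Win.mono ?_ (Finset.Subset.refl _) ?_ (hw0.le (Nat.le_add_right k0 _))
      · exact_mod_cast Finset.subset_union_left
      · intro x hx hxW
        rcases Finset.mem_union.1 hx with hx | hx
        · exact Finset.mem_union_left _ hx
        · exact absurd hxW (by exact_mod_cast hYW x hx)

/-- padding -/
theorem exists_pad (X D : Finset Cell) (a : ℕ) (hX : X.card ≤ a) (hd : Disjoint X D) :
    ∃ X' : Finset Cell, X ⊆ X' ∧ X'.card = a ∧ Disjoint X' D := by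
  obtain ⟨Z, hZ, hZc⟩ := ((D ∪ X : Finset Cell).finite_toSet.infinite_compl).exists_subset_card_eq
    (a - X.card)
  have hZ1 : ∀ z ∈ Z, z ∉ D ∧ z ∉ X := by
    intro z hz
    have := hZ hz
    simpa [not_or] using this
  refine ⟨X ∪ Z, Finset.subset_union_left, ?_, ?_⟩
  · rw [Finset.card_union_of_disjoint, hZc]
    · omega
    · rw [Finset.disjoint_right]
      exact fun z hz => (hZ1 z hz).2
  · rw [Finset.disjoint_union_left]
    exact ⟨hd, Finset.disjoint_left.2 fun z hz => (hZ1 z hz).1⟩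

def Hot (A : Finset Cell) (a b : ℕ) (M B : Finset Cell) : Prop :=
  ∃ (W : Finset Cell) (k : ℕ), Win A a b ↑W k M B

theorem not_hot_step {A : Finset Cell} {a b : ℕ} {M B X : Finset Cell} (h : ¬ Hot A a b M B)
    (hX : X.card ≤ a) (hXB : Disjoint X B) :
    ∃ Y : Finset Cell, Y.card = b ∧ Disjoint Y ((M ∪ X) ∪ B) ∧
      ¬ Hot A a b (M ∪ X) (B ∪ Y) := by
  by_contra hcon
  push Not at hcon
  apply h
  obtain ⟨W, k, hw⟩ := uniform_win (A := A) (a := a) (c := b) (M ∪ X) b B (by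
    intro Y hY hd
    obtain ⟨Y', h1, h2, h3⟩ := exists_pad (Y \ B) ((M ∪ X) ∪ B) b
      ((Finset.card_le_card Finset.sdiff_subset).trans hY) (by
        rw [Finset.disjoint_union_right]
        exact ⟨hd.mono_left Finset.sdiff_subset, Finset.sdiff_disjoint⟩)
    obtain ⟨W, k, hw⟩ := hcon Y' h2 h3
    refine ⟨W, k, hw.mono (Set.Subset.refl _) (Finset.Subset.refl _) ?_⟩
    intro x hx _
    by_cases hxB : x ∈ B
    · exact Finset.mem_union_left _ hxB
    · refine Finset.mem_union_right _ (h1 ?_)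
      simp only [Finset.mem_union, Finset.mem_sdiff] at hx ⊢
      tauto)
  refine ⟨W ∪ X, k + 1, X, ?_, hX, hXB, ?_⟩
  · exact_mod_cast Finset.subset_union_right
  · intro Y hY hd
    refine (hw Y hY hd).mono ?_ (Finset.Subset.refl _) (fun _ h _ => h)
    exact_mod_cast Finset.subset_union_left

def bState (σ : List (Finset Cell) → Finset Cell) (f : Finset Cell → Finset Cell → Finset Cell) :
    ℕ → List (Finset Cell) × Finset Cell × Finset Cell
  | 0 => ([], ∅, ∅)
  | n + 1 =>
    let s := bState σ f n
    (s.1 ++ [f (s.2.1 ∪ σ s.1) s.2.2], s.2.1 ∪ σ s.1, s.2.2 ∪ f (s.2.1 ∪ σ s.1) s.2.2)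

theorem exists_play (σ : List (Finset Cell) → Finset Cell)
    (f : Finset Cell → Finset Cell → Finset Cell) :
    ∃ β : ℕ → Finset Cell, ∀ n, β n = f (makerMarks σ β (n + 1)) (breakerMarks β n) := by
  let β : ℕ → Finset Cell := fun n =>
    f ((bState σ f n).2.1 ∪ σ (bState σ f n).1) (bState σ f n).2.2
  have key : ∀ n, bState σ f n = ((List.range n).map β, makerMarks σ β n, breakerMarks β n) := by
    intro n
    induction n with
    | zero => simp [bState, makerMarks, breakerMarks]
    | succ n ih =>
      have hβ : f ((bState σ f n).2.1 ∪ σ (bState σ f n).1) (bState σ f n).2.2 = β n := rfl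
      simp only [bState, hβ]
      rw [ih]
      simp [List.range_succ, makerMarks, breakerMarks, makerMove]
  refine ⟨β, fun n => ?_⟩
  have : β n = f ((bState σ f n).2.1 ∪ σ (bState σ f n).1) (bState σ f n).2.2 := rfl
  rw [this, key n]
  rfl

theorem hot_of_isWinner {A : Finset Cell} {a b : ℕ} (h : IsWinner A a b) : Hot A a b ∅ ∅ := by
  classical
  by_contra hn
  obtain ⟨σ, hσ⟩ := h
  have hf : ∀ M B : Finset Cell, ∃ Y : Finset Cell, (Y.card = b ∧ Disjoint Y (M ∪ B)) ∧
      ((∃ Y : Finset Cell, Y.card = b ∧ Disjoint Y (M ∪ B) ∧ ¬ Hot A a b M (B ∪ Y)) →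
        ¬ Hot A a b M (B ∪ Y)) := by
    intro M B
    by_cases hex : ∃ Y : Finset Cell, Y.card = b ∧ Disjoint Y (M ∪ B) ∧ ¬ Hot A a b M (B ∪ Y)
    · obtain ⟨Y, h1, h2, h3⟩ := hex
      exact ⟨Y, ⟨h1, h2⟩, fun _ => h3⟩
    · obtain ⟨Y, _, h1, h2⟩ := exists_pad ∅ (M ∪ B) b (by simp) (by simp)
      exact ⟨Y, ⟨h1, h2⟩, fun h => absurd h hex⟩
  choose f hf1 hf2 using hf
  obtain ⟨β, hβ⟩ := exists_play σ f
  obtain ⟨hleg, n, P, hP, hPM⟩ := hσ β (by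
    intro n
    rw [hβ n]
    exact hf1 _ _)
  have key : ∀ n, ¬ Hot A a b (makerMarks σ β n) (breakerMarks β n) := by
    intro n
    induction n with
    | zero => exact hn
    | succ n ih =>
      have h1 := not_hot_step ih (hleg n).1.le ((hleg n).2.mono_right Finset.subset_union_right)
      have h2 := hf2 (makerMarks σ β (n + 1)) (breakerMarks β n) h1
      rw [← hβ n] at h2
      exact h2
  exact key n ⟨∅, 0, P, hP, hPM⟩

theorem isWinner_of_win {A : Finset Cell} {a b K : ℕ} (h : Win A a b Set.univ K ∅ ∅) :
    IsWinner A a b := by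
  classical
  have hf : ∀ (t : ℕ) (M B : Finset Cell), ∃ X : Finset Cell, X.card = a ∧ Disjoint X (M ∪ B) ∧
      (Win A a b Set.univ t M B → ∀ Y : Finset Cell, Y.card ≤ b → Disjoint Y (M ∪ X) →
        Win A a b Set.univ (t - 1) (M ∪ X) (B ∪ Y)) := by
    intro t M B
    by_cases hw : Win A a b Set.univ t M B
    · have hw' : Win A a b Set.univ (t - 1 + 1) M B := hw.le (by omega)
      obtain ⟨X, _, hX, hXB, hXw⟩ := hw'
      obtain ⟨X', h1, h2, h3⟩ := exists_pad (X \ M) (M ∪ B) a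
        ((Finset.card_le_card Finset.sdiff_subset).trans hX) (by
          rw [Finset.disjoint_union_right]
          exact ⟨Finset.sdiff_disjoint, hXB.mono_left Finset.sdiff_subset⟩)
      have hsub : M ∪ X ⊆ M ∪ X' := by
        intro x hx
        by_cases hxM : x ∈ M
        · exact Finset.mem_union_left _ hxM
        · refine Finset.mem_union_right _ (h1 ?_)
          simp only [Finset.mem_union, Finset.mem_sdiff] at hx ⊢
          tauto
      exact ⟨X', h2, h3, fun _ Y hY hd => (hXw Y hY (hd.mono_right hsub)).mono
        (Set.Subset.refl _) hsub (fun _ h _ => h)⟩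
    · obtain ⟨Y, _, h1, h2⟩ := exists_pad ∅ (M ∪ B) a (by simp) (by simp)
      exact ⟨Y, h1, h2, fun h => absurd h hw⟩
  choose mv hm1 hm2 hm3 using hf
  let st : List (Finset Cell) → ℕ × Finset Cell × Finset Cell := fun l =>
    l.foldl (fun s Y => (s.1 - 1, s.2.1 ∪ mv s.1 s.2.1 s.2.2, s.2.2 ∪ Y)) (K, ∅, ∅)
  let σ : List (Finset Cell) → Finset Cell := fun l => mv (st l).1 (st l).2.1 (st l).2.2
  refine ⟨σ, fun β hβ => ?_⟩
  have key : ∀ n, st ((List.range n).map β) = (K - n, makerMarks σ β n, breakerMarks β n) := by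
    intro n
    induction n with
    | zero => rfl
    | succ n ih =>
      have h1 : st ((List.range (n + 1)).map β) =
        ((st ((List.range n).map β)).1 - 1,
          (st ((List.range n).map β)).2.1 ∪ σ ((List.range n).map β),
          (st ((List.range n).map β)).2.2 ∪ β n) := by
        simp [st, σ, List.range_succ]
      rw [h1, ih]
      rfl
  have hmove : ∀ n, makerMove σ β n = mv (K - n) (makerMarks σ β n) (breakerMarks β n) := by
    intro n
    change mv (st ((List.range n).map β)).1 (st ((List.range n).map β)).2.1
      (st ((List.range n).map β)).2.2 = _
    rw [key n]
  refine ⟨fun n => ?_, K, ?_⟩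
  · rw [hmove n]
    exact ⟨hm1 _ _ _, hm2 _ _ _⟩
  · have hw : ∀ n, Win A a b Set.univ (K - n) (makerMarks σ β n) (breakerMarks β n) := by
      intro n
      induction n with
      | zero => exact h
      | succ n ih =>
        have hb := hβ n
        have e : makerMarks σ β (n + 1) =
          makerMarks σ β n ∪ mv (K - n) (makerMarks σ β n) (breakerMarks β n) := by
          rw [← hmove n]; rfl
        rw [e] at hb ⊢
        exact hm3 _ _ _ ih (β n) hb.1.le (hb.2.mono_right Finset.subset_union_left)
    have := hw K
    rw [Nat.sub_self] at this
    exact this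

theorem Win.translate {A : Finset Cell} {a b : ℕ} {W : Finset Cell} (t : Cell) {k : ℕ} :
    ∀ {M B : Finset Cell}, Win A a b ↑W k M B →
      Win A a b ↑(W.map (Equiv.addRight t).toEmbedding) k
        (M.map (Equiv.addRight t).toEmbedding) (B.map (Equiv.addRight t).toEmbedding) := by
  induction k with
  | zero =>
    rintro M B ⟨P, ⟨f, ⟨e₁, e₂, s, t', h1, h2, hf⟩, rfl⟩, hPM⟩
    refine ⟨_, ⟨fun p => f p + t, ⟨e₁, e₂, s, t' + t, h1, h2, ?_⟩, rfl⟩, ?_⟩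
    · intro p
      change f p + t = _
      rw [hf p]
      cases s <;> simp [Prod.ext_iff, add_assoc]
    · rintro _ ⟨p, hp, rfl⟩
      have : f p ∈ M := hPM ⟨p, hp, rfl⟩
      simpa using this
  | succ k ih =>
    rintro M B ⟨X, hXW, hXc, hXB, h⟩
    refine ⟨X.map (Equiv.addRight t).toEmbedding, ?_, by simpa using hXc, ?_, ?_⟩
    · have : X ⊆ W := by exact_mod_cast hXW
      exact_mod_cast Finset.map_subset_map.2 this
    · exact (Finset.disjoint_map _).2 hXB
    · intro Y hY hd
      have e : Y = (Y.map (Equiv.addRight t).symm.toEmbedding).map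
          (Equiv.addRight t).toEmbedding := by
        rw [Finset.map_map]
        ext x; simp
      rw [e] at hd ⊢
      rw [← Finset.map_union] at hd ⊢
      rw [← Finset.map_union]
      exact ih (h _ (by simpa using hY) ((Finset.disjoint_map _).1 hd))

def Pre (A : Finset Cell) (n b : ℕ) (W : Finset Cell) (k s : ℕ) (M B : Finset Cell) : Prop :=
  ∃ X : Finset Cell, X ⊆ W ∧ Disjoint X B ∧ (X \ M).card ≤ s ∧
    ∀ Y : Finset Cell, Y.card ≤ b → Disjoint Y (M ∪ X) → Win A n b ↑W k (M ∪ X) (B ∪ Y)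

def Good (A : Finset Cell) (n b : ℕ) (W : Finset Cell) (k l : ℕ) (M B : Finset Cell) : Prop :=
  ∀ Y : Finset Cell, Y.card < l → Disjoint Y M → Win A n b ↑W k M (B ∪ Y)

theorem Pre.mono {A : Finset Cell} {n b : ℕ} {W : Finset Cell} {k s : ℕ} {M M' B B' : Finset Cell}
    (h : Pre A n b W k s M B) (hM : M ⊆ M') (hB : ∀ x ∈ B', x ∈ W → x ∈ B) :
    Pre A n b W k s M' B' := by
  obtain ⟨X, hXW, hXB, hXs, hX⟩ := h
  refine ⟨X, hXW, ?_, ?_, ?_⟩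
  · rw [Finset.disjoint_left] at hXB ⊢
    exact fun x hx hx' => hXB hx (hB x hx' (hXW hx))
  · exact (Finset.card_le_card (Finset.sdiff_subset_sdiff (Finset.Subset.refl _) hM)).trans hXs
  · intro Y hY hd
    have hs : M ∪ X ⊆ M' ∪ X := Finset.union_subset_union_left hM
    refine (hX Y hY (hd.mono_right hs)).mono (Set.Subset.refl _) hs ?_
    intro x hx hxW
    rcases Finset.mem_union.1 hx with hx | hx
    · exact Finset.mem_union_left _ (hB x hx (by exact_mod_cast hxW))
    · exact Finset.mem_union_right _ hx

theorem Pre.play {A : Finset Cell} {n b : ℕ} {W : Finset Cell} {k s : ℕ} {M B : Finset Cell}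
    (h : Pre A n b W k s M B) (r : ℕ) :
    ∃ C : Finset Cell, C.card ≤ r ∧ Disjoint C B ∧
      ∀ M', M ∪ C ⊆ M' → Pre A n b W k (s - r) M' B := by
  obtain ⟨X, hXW, hXB, hXs, hX⟩ := h
  obtain ⟨C, hC, hCc⟩ := Finset.exists_subset_card_eq
    (s := X \ M) (n := min r (X \ M).card) (min_le_right _ _)
  refine ⟨C, hCc.le.trans (min_le_left _ _),
    hXB.mono_left (hC.trans Finset.sdiff_subset), fun M' hM' => ?_⟩
  have h1 : Pre A n b W k (s - r) (M ∪ C) B := by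
    refine ⟨X, hXW, hXB, ?_, ?_⟩
    · have e : X \ (M ∪ C) = (X \ M) \ C := by
        ext x; simp only [Finset.mem_sdiff, Finset.mem_union]; tauto
      rw [e, Finset.card_sdiff_of_subset hC]
      omega
    · have e : M ∪ C ∪ X = M ∪ X := by
        rw [Finset.union_assoc, Finset.union_eq_right.2 (hC.trans Finset.sdiff_subset)]
      rw [e]
      exact hX
  exact h1.mono hM' (fun _ h _ => h)

theorem Pre.good {A : Finset Cell} {n b : ℕ} {W : Finset Cell} {k : ℕ} {M B : Finset Cell}
    (h : Pre A n b W k 0 M B) : Good A n b W k (b + 1) M B := by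
  obtain ⟨X, hXW, hXB, hXs, hX⟩ := h
  have hXM : X ⊆ M := by
    rw [← Finset.sdiff_eq_empty_iff_subset]; simpa using hXs
  rw [Finset.union_eq_left.2 hXM] at hX
  exact fun Y hY hd => hX Y (by omega) hd

theorem Good.step {A : Finset Cell} {n b : ℕ} {W : Finset Cell} {k l : ℕ} {M M' B Y : Finset Cell}
    (h : Good A n b W k l M B) (hM : M ⊆ M') (hY : Disjoint Y M') :
    Good A n b W k (l - (Y ∩ W).card) M' (B ∪ Y) := by
  intro Z hZ hd
  have h1 := Finset.card_union_le (Y ∩ W) Z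
  have h2 := h (Y ∩ W ∪ Z) (by omega) (by
    rw [Finset.disjoint_union_left]
    exact ⟨(hY.mono_left Finset.inter_subset_left).mono_right hM, hd.mono_right hM⟩)
  refine h2.mono (Set.Subset.refl _) hM ?_
  intro x hx hxW
  have hxW' : x ∈ W := by exact_mod_cast hxW
  simp only [Finset.mem_union, Finset.mem_inter] at hx ⊢
  tauto

theorem sum_inter_le {W : ℕ → Finset Cell} (hW : ∀ i j, i ≠ j → Disjoint (W i) (W j))
    (Y : Finset Cell) (J : Finset ℕ) : ∑ j ∈ J, (Y ∩ W j).card ≤ Y.card := by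
  rw [← Finset.card_biUnion]
  · apply Finset.card_le_card
    intro x hx
    simp only [Finset.mem_biUnion, Finset.mem_inter] at hx
    obtain ⟨_, _, h, _⟩ := hx
    exact h
  · intro i _ j _ hij
    exact (hW i j hij).mono Finset.inter_subset_right Finset.inter_subset_right

theorem phase {A : Finset Cell} {n b : ℕ} {W : ℕ → Finset Cell}
    (hW : ∀ i j, i ≠ j → Disjoint (W i) (W j)) {k N K : ℕ}
    (H : ∀ (M B : Finset Cell) (I : Finset ℕ), N ≤ I.card →
      (∀ i ∈ I, Win A n b ↑(W i) k M B) → Win A (n + 1) (b + 1) Set.univ K M B) (m : ℕ) :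
    ∀ (M B : Finset Cell) (U G : Finset ℕ) (p s : ℕ) (l : ℕ → ℕ),
      p ∉ U → p ∉ G → Disjoint U G → s ≤ n → m * (b + 3) ≤ U.card →
      (∀ i ∈ U, Pre A n b (W i) k n M B) → Pre A n b (W p) k s M B →
      (∀ i ∈ G, l i ≤ b + 1 ∧ Good A n b (W i) k (l i) M B) →
      ((b + 1) * N - ∑ i ∈ G, l i) * (n + 1) + s ≤ m →
      Win A (n + 1) (b + 1) Set.univ (K + m) M B := by
  have hdone : ∀ (M B : Finset Cell) (G : Finset ℕ) (l : ℕ → ℕ),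
      (∀ i ∈ G, l i ≤ b + 1 ∧ Good A n b (W i) k (l i) M B) →
      (b + 1) * N ≤ ∑ i ∈ G, l i → Win A (n + 1) (b + 1) Set.univ K M B := by
    intro M B G l hG hL
    refine H M B (G.filter (fun i => l i ≠ 0)) ?_ ?_
    · rw [← Finset.sum_filter_ne_zero] at hL
      have h1 := Finset.sum_le_card_nsmul (G.filter (fun i => l i ≠ 0)) l (b + 1)
        (fun i hi => (hG i (Finset.mem_filter.1 hi).1).1)
      rw [smul_eq_mul, mul_comm] at h1
      exact Nat.le_of_mul_le_mul_left (hL.trans h1) (Nat.succ_pos b)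
    · intro i hi
      have := (hG i (Finset.mem_filter.1 hi).1).2 ∅
        (by simpa using Nat.pos_of_ne_zero (Finset.mem_filter.1 hi).2) (by simp)
      simpa using this
  induction m with
  | zero =>
    intro M B U G p s l hpU hpG hUG hs hU hUp hp hG hm
    have h0 : ((b + 1) * N - ∑ i ∈ G, l i) * (n + 1) = 0 := by omega
    rcases Nat.mul_eq_zero.1 h0 with h0 | h0
    · exact hdone M B G l hG (by omega)
    · omega
  | succ m ih =>
    intro M B U G p s l hpU hpG hUG hs hU hUp hp hG hm
    by_cases hL : (b + 1) * N ≤ ∑ i ∈ G, l i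
    · exact (hdone M B G l hG hL).le (by omega)
    push Not at hL
    have hmul : ∀ L', ∑ i ∈ G, l i < L' → ((b + 1) * N - L') * (n + 1) + n ≤ m := by
      intro L' hL'
      have h1 : ((b + 1) * N - L') + 1 ≤ (b + 1) * N - ∑ i ∈ G, l i := by omega
      have h2 := Nat.mul_le_mul_right (n + 1) h1
      rw [Nat.add_mul] at h2
      omega
    have hmb : (m + 1) * (b + 3) = m * (b + 3) + (b + 3) := by ring
    have hUne : U.Nonempty := by
      rw [← Finset.card_pos]; omega
    obtain ⟨i, hi⟩ := hUne
    have hip : i ≠ p := fun h => hpU (h ▸ hi)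
    have hiG : i ∉ G := Finset.disjoint_left.1 hUG hi
    rcases Nat.eq_zero_or_pos s with rfl | hs0
    · -- convert the spare board
      have hsum : ∑ j ∈ insert p G, Function.update l p (b + 1) j = (b + 1) + ∑ j ∈ G, l j := by
        rw [Finset.sum_insert hpG, Function.update_self]
        congr 1
        refine Finset.sum_congr rfl fun j hj => ?_
        rw [Function.update_of_ne]
        rintro rfl
        exact hpG hj
      refine (ih M B (U.erase i) (insert p G) i n (Function.update l p (b + 1))
        (Finset.notMem_erase _ _) ?_ ?_ le_rfl ?_ ?_ (hUp i hi) ?_ ?_).le (by omega)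
      · simp [hip, hiG]
      · rw [Finset.disjoint_insert_right]
        exact ⟨fun h => hpU (Finset.mem_of_mem_erase h), hUG.mono_left (Finset.erase_subset _ _)⟩
      · rw [Finset.card_erase_of_mem hi]; omega
      · exact fun j hj => hUp j (Finset.mem_of_mem_erase hj)
      · intro j hj
        by_cases hjp : j = p
        · subst hjp
          rw [Function.update_self]
          exact ⟨le_rfl, hp.good⟩
        · rw [Function.update_of_ne hjp]
          exact hG j (Finset.mem_of_mem_insert_of_ne hj hjp)
      · rw [hsum]
        exact hmul _ (by omega)
    · obtain ⟨X, hXc, hXB, hXp⟩ := (hUp i hi).play n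
      obtain ⟨C, hCc, hCB, hCp⟩ := hp.play 1
      rw [Nat.sub_self] at hXp
      rw [← Nat.add_assoc]
      refine ⟨X ∪ C, Set.subset_univ _, (Finset.card_union_le _ _).trans (by omega),
        Finset.disjoint_union_left.2 ⟨hXB, hCB⟩, ?_⟩
      intro Y hY hYd
      set M' := M ∪ (X ∪ C) with hM'
      have hMM' : M ⊆ M' := Finset.subset_union_left
      have gi : Good A n b (W i) k (b + 1) M' B := (hXp M' (by
        rw [hM']; exact Finset.union_subset_union_right Finset.subset_union_left)).good
      have gp : Pre A n b (W p) k (s - 1) M' B := hCp M' (by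
        rw [hM']; exact Finset.union_subset_union_right Finset.subset_union_right)
      let l1 := Function.update l i (b + 1)
      let l' : ℕ → ℕ := fun j => l1 j - (Y ∩ W j).card
      have hsum1 : ∑ j ∈ insert i G, l1 j = (b + 1) + ∑ j ∈ G, l j := by
        rw [Finset.sum_insert hiG]
        simp only [l1]
        rw [Function.update_self]
        congr 1
        refine Finset.sum_congr rfl fun j hj => ?_
        rw [Function.update_of_ne]
        rintro rfl
        exact hiG hj
      have hsum2 : ∑ j ∈ insert i G, l1 j ≤
          ∑ j ∈ insert i G, l' j + ∑ j ∈ insert i G, (Y ∩ W j).card := by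
        rw [← Finset.sum_add_distrib]
        refine Finset.sum_le_sum fun j _ => ?_
        simp only [l']
        omega
      have hG' : ∀ j ∈ insert i G, l' j ≤ b + 1 ∧ Good A n b (W j) k (l' j) M' (B ∪ Y) := by
        intro j hj
        by_cases hji : j = i
        · subst hji
          simp only [l', l1, Function.update_self]
          exact ⟨by omega, gi.step (Finset.Subset.refl _) hYd⟩
        · simp only [l', l1, Function.update_of_ne hji]
          have := hG j (Finset.mem_of_mem_insert_of_ne hj hji)
          exact ⟨by omega, this.2.step hMM' hYd⟩
      let U' := (U.erase i).filter (fun j => Disjoint Y (W j))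
      have hloc : ∀ j, Disjoint Y (W j) → ∀ x ∈ B ∪ Y, x ∈ W j → x ∈ B := by
        intro j hj x hx hxW
        rcases Finset.mem_union.1 hx with hx | hx
        · exact hx
        · exact absurd hxW (Finset.disjoint_left.1 hj hx)
      have hU'sub : U' ⊆ U.erase i := Finset.filter_subset _ _
      have hU'p : ∀ j ∈ U', Pre A n b (W j) k n M' (B ∪ Y) := by
        intro j hj
        exact (hUp j (Finset.mem_of_mem_erase (hU'sub hj))).mono hMM'
          (hloc j (Finset.mem_filter.1 hj).2)
      have hU'c : m * (b + 3) + 1 ≤ U'.card := by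
        have h1 := Finset.card_filter_add_card_filter_not (s := U.erase i)
          (fun j => Disjoint Y (W j))
        rw [Finset.card_erase_of_mem hi] at h1
        have h2 : ((U.erase i).filter (fun j => ¬ Disjoint Y (W j))).card ≤ Y.card := by
          refine le_trans ?_ (sum_inter_le hW Y ((U.erase i).filter (fun j => ¬ Disjoint Y (W j))))
          rw [Finset.card_eq_sum_ones]
          refine Finset.sum_le_sum fun j hj => ?_
          have := (Finset.mem_filter.1 hj).2
          rw [Finset.not_disjoint_iff_nonempty_inter] at this
          exact this.card_pos
        have h3 : U'.card = ((U.erase i).filter (fun j => Disjoint Y (W j))).card := rfl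
        omega
      have hpG' : p ∉ insert i G := by
        simp [hpG, hip.symm]
      have hdisj : Disjoint U' (insert i G) := by
        rw [Finset.disjoint_insert_right]
        exact ⟨fun h => Finset.notMem_erase i U (hU'sub h),
          hUG.mono_left (hU'sub.trans (Finset.erase_subset _ _))⟩
      by_cases hYp : Disjoint Y (W p)
      · refine ih M' (B ∪ Y) U' (insert i G) p (s - 1) l' ?_ hpG' hdisj (by omega) (by omega)
          hU'p (gp.mono (Finset.Subset.refl _) (hloc p hYp)) hG' ?_
        · exact fun h => hpU (Finset.mem_of_mem_erase (hU'sub h))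
        · have h1 := sum_inter_le hW Y (insert i G)
          have h2 : ((b + 1) * N - ∑ j ∈ insert i G, l' j) ≤ (b + 1) * N - ∑ j ∈ G, l j := by
            omega
          have h3 := Nat.mul_le_mul_right (n + 1) h2
          omega
      · have hne : U'.Nonempty := by
          rw [← Finset.card_pos]; omega
        obtain ⟨q, hq⟩ := hne
        refine ih M' (B ∪ Y) (U'.erase q) (insert i G) q n l' (Finset.notMem_erase _ _)
          (Finset.disjoint_left.1 hdisj hq) (hdisj.mono_left (Finset.erase_subset _ _)) le_rfl ?_
          (fun j hj => hU'p j (Finset.mem_of_mem_erase hj)) (hU'p q hq) hG' ?_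
        · rw [Finset.card_erase_of_mem hq]; omega
        · apply hmul
          have h1 := sum_inter_le hW Y (insert p (insert i G))
          rw [Finset.sum_insert hpG'] at h1
          rw [Finset.not_disjoint_iff_nonempty_inter] at hYp
          have := hYp.card_pos
          omega

theorem multi {A : Finset Cell} {n b : ℕ} {W : ℕ → Finset Cell}
    (hW : ∀ i j, i ≠ j → Disjoint (W i) (W j)) (k : ℕ) :
    ∃ N K : ℕ, ∀ (M B : Finset Cell) (I : Finset ℕ), N ≤ I.card →
      (∀ i ∈ I, Win A n b ↑(W i) k M B) → Win A (n + 1) (b + 1) Set.univ K M B := by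
  induction k with
  | zero =>
    refine ⟨1, 0, fun M B I hI h => ?_⟩
    obtain ⟨i, hi⟩ := Finset.card_pos.1 hI
    exact h i hi
  | succ k ih =>
    obtain ⟨N, K, H⟩ := ih
    refine ⟨((b + 1) * N * (n + 1) + n) * (b + 3) + 1, K + ((b + 1) * N * (n + 1) + n),
      fun M B I hI h => ?_⟩
    have hpre : ∀ i ∈ I, Pre A n b (W i) k n M B := by
      intro i hi
      obtain ⟨X, h1, h2, h3, h4⟩ := h i hi
      exact ⟨X, by exact_mod_cast h1, h3,
        (Finset.card_le_card Finset.sdiff_subset).trans h2, h4⟩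
    obtain ⟨p, hp⟩ := Finset.card_pos.1 (lt_of_lt_of_le (Nat.succ_pos _) hI)
    refine phase hW H _ M B (I.erase p) ∅ p n (fun _ => 0) (Finset.notMem_erase _ _) (by simp)
      (by simp) le_rfl ?_ (fun i hi => hpre i (Finset.mem_of_mem_erase hi)) (hpre p hp)
      (by simp) (by simp)
    rw [Finset.card_erase_of_mem hp]
    omega

theorem isWinner_succ {A : Finset Cell} {n b : ℕ} (h : IsWinner A n b) :
    IsWinner A (n + 1) (b + 1) := by
  obtain ⟨W0, k, hw⟩ := hot_of_isWinner h
  obtain ⟨D, hD⟩ : ∃ D : ℕ, ∀ x ∈ W0, x.1.natAbs < D :=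
    ⟨W0.sup (fun x => x.1.natAbs) + 1, fun x hx =>
      Nat.lt_succ_of_le (Finset.le_sup (f := fun x : Cell => x.1.natAbs) hx)⟩
  let W : ℕ → Finset Cell := fun i =>
    W0.map (Equiv.addRight (((2 * D * i : ℕ) : ℤ), (0 : ℤ)) : Cell ≃ Cell).toEmbedding
  have hlt : ∀ i j, i < j → Disjoint (W i) (W j) := by
    intro i j hij
    rw [Finset.disjoint_left]
    intro x hx hx'
    simp only [W, Finset.mem_map] at hx hx'
    obtain ⟨y, hy, rfl⟩ := hx
    obtain ⟨z, hz, hzy⟩ := hx'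
    have e := congrArg Prod.fst hzy
    simp only [Equiv.coe_toEmbedding, Equiv.coe_addRight, Prod.fst_add] at e
    have h1 := hD y hy
    have h2 := hD z hz
    have h3 : 2 * D * (i + 1) ≤ 2 * D * j := Nat.mul_le_mul_left _ hij
    rw [Nat.mul_add] at h3
    omega
  have hW : ∀ i j, i ≠ j → Disjoint (W i) (W j) := by
    intro i j hij
    rcases lt_or_gt_of_ne hij with h | h
    · exact hlt i j h
    · exact (hlt j i h).symm
  obtain ⟨N, K, H⟩ := multi (A := A) (n := n) (b := b) hW k
  refine isWinner_of_win (H ∅ ∅ (Finset.range N) (by simp) fun i _ => ?_)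
  have := hw.translate (((2 * D * i : ℕ) : ℤ), (0 : ℤ))
  simpa only [Finset.map_empty] using this

theorem isWinner_zero {A : Finset Cell} {n : ℕ} (hn : 1 ≤ n) : IsWinner A n 0 := by
  have key : ∀ (m : ℕ) (M : Finset Cell), (A \ M).card ≤ m → Win A n 0 Set.univ m M ∅ := by
    intro m
    induction m with
    | zero =>
      intro M hM
      have hAM : A ⊆ M := by
        rw [← Finset.sdiff_eq_empty_iff_subset]; simpa using hM
      refine ⟨_, ⟨id, ⟨1, 1, false, 0, by simp, by simp, by simp⟩, rfl⟩, ?_⟩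
      simpa using hAM
    | succ m ih =>
      intro M hM
      rcases (A \ M).eq_empty_or_nonempty with he | ⟨x, hx⟩
      · exact (ih M (by simp [he])).succ
      · refine ⟨{x}, Set.subset_univ _, by simpa using hn, by simp, ?_⟩
        intro Y hY _
        have hY0 : Y = ∅ := by simpa using hY
        rw [hY0, Finset.union_empty]
        apply ih
        have : A \ (M ∪ {x}) ⊆ (A \ M).erase x := by
          intro y hy
          simp only [Finset.mem_sdiff, Finset.mem_union, Finset.mem_erase,
            Finset.mem_singleton] at hy ⊢
          tauto
        have := Finset.card_le_card this
        rw [Finset.card_erase_of_mem hx] at this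
        omega
  exact isWinner_of_win (key _ ∅ le_rfl)

/-- For every polyomino `A` and `n ≥ 1`, `τ(A)(n) + 1 ≤ τ(A)(n+1)`; in particular, if
`τ(A)(n)` is finite then `τ(A)(n) < τ(A)(n+1)`. -/
theorem tau_strict_mono (A : Finset Cell) (hA : IsPolyomino A) (n : ℕ) (hn : 1 ≤ n) :
    tau A n + 1 ≤ tau A (n + 1) ∧ (tau A n ≠ ⊤ → tau A n < tau A (n + 1)) := by
  have h1 : tau A n + 1 ≤ tau A (n + 1) := by
    unfold tau
    rw [ENat.biSup_add' ⟨0, isWinner_zero hn⟩]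
    refine iSup₂_le fun b hb => ?_
    have := le_iSup₂ (f := fun (b : ℕ) (_ : IsWinner A (n + 1) b) => (b : ℕ∞)) (b + 1)
      (isWinner_succ hb)
    simpa using this
  exact ⟨h1, fun h => (ENat.add_one_le_iff h).1 h1⟩
end

section
/- The domino P₂,₁ = {(0,0),(0,1)} has threshold sequence (3,∞): it is a (1,3)-winner, it is a (1,4)-loser, and it is an (n,b)-winner for every n ≥ 2 and every b ∈ ℕ. -/
/-- The domino `P₂,₁`. -/
def P21 : Finset Cell := {(0, 0), (0, 1)}

/-- The four neighbours of a cell. -/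
def nb (p : Cell) : Finset Cell :=
  {(p.1 + 1, p.2), (p.1 - 1, p.2), (p.1, p.2 + 1), (p.1, p.2 - 1)}

lemma mem_nb (p q : Cell) : q ∈ nb p ↔
    q = (p.1 + 1, p.2) ∨ q = (p.1 - 1, p.2) ∨ q = (p.1, p.2 + 1) ∨ q = (p.1, p.2 - 1) := by
  simp [nb]

lemma nb_symm {p q : Cell} (h : q ∈ nb p) : p ∈ nb q := by
  obtain ⟨a, b⟩ := p
  obtain ⟨c, d⟩ := q
  simp only [mem_nb, Prod.mk.injEq] at h ⊢
  omega

lemma nb_card (p : Cell) : (nb p).card = 4 := by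
  obtain ⟨a, b⟩ := p
  unfold nb
  rw [Finset.card_insert_of_notMem, Finset.card_insert_of_notMem,
    Finset.card_insert_of_notMem, Finset.card_singleton]
  all_goals
    simp only [Finset.mem_insert, Finset.mem_singleton, Prod.mk.injEq]
    omega

lemma self_notMem_nb (p : Cell) : p ∉ nb p := by
  obtain ⟨a, b⟩ := p
  simp only [mem_nb, Prod.mk.injEq]
  omega

lemma placement_of_nb {p q : Cell} (h : q ∈ nb p) (S : Finset Cell) (hp : p ∈ S) (hq : q ∈ S) :
    ∃ P : Set Cell, IsPlacement P21 P ∧ P ⊆ ↑S := by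
  have key : ∃ f : Cell → Cell, IsSquareSymmetry f ∧ f (0, 0) = p ∧ f (0, 1) = q := by
    rw [mem_nb] at h
    rcases h with h | h | h | h
    · exact ⟨fun r => (1 * r.2 + p.1, 1 * r.1 + p.2),
        ⟨1, 1, true, p, by simp, by simp, by simp⟩, by simp, by rw [h]; simp [add_comm]⟩
    · exact ⟨fun r => (-1 * r.2 + p.1, 1 * r.1 + p.2),
        ⟨-1, 1, true, p, by simp, by simp, by simp⟩, by simp, by rw [h]; simp; ring⟩
    · exact ⟨fun r => (1 * r.1 + p.1, 1 * r.2 + p.2),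
        ⟨1, 1, false, p, by simp, by simp, by simp⟩, by simp, by rw [h]; simp [add_comm]⟩
    · exact ⟨fun r => (1 * r.1 + p.1, -1 * r.2 + p.2),
        ⟨1, -1, false, p, by simp, by simp, by simp⟩, by simp, by rw [h]; simp; ring⟩
  obtain ⟨f, hf, h0, h1⟩ := key
  refine ⟨_, ⟨f, hf, rfl⟩, ?_⟩
  rintro _ ⟨x, hx, rfl⟩
  have hx2 : x = (0, 0) ∨ x = (0, 1) := by simpa [P21] using hx
  rcases hx2 with rfl | rfl
  · rw [h0]; exact hp
  · rw [h1]; exact hq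

lemma nb_of_placement {P : Set Cell} (h : IsPlacement P21 P) : ∃ p ∈ P, ∃ q ∈ P, q ∈ nb p := by
  obtain ⟨f, ⟨e1, e2, s, t, h1, h2, hf⟩, rfl⟩ := h
  refine ⟨f (0, 0), ⟨_, by simp [P21], rfl⟩, f (0, 1), ⟨_, by simp [P21], rfl⟩, ?_⟩
  rw [hf, hf, mem_nb]
  cases s <;> rcases h1 with rfl | rfl <;> rcases h2 with rfl | rfl <;>
    simp only [true_and, and_true, Prod.mk.injEq, ↓reduceIte, Bool.false_eq_true] <;> omega

lemma exists_extend (U D : Finset Cell) (a : ℕ) (hd : Disjoint D U) (hc : D.card ≤ a) :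
    ∃ T : Finset Cell, D ⊆ T ∧ T.card = a ∧ Disjoint T U := by
  have h1 : (D ∪ U).card = D.card + U.card := Finset.card_union_of_disjoint hd
  obtain ⟨t, ht, hcard⟩ := Infinite.exists_superset_card_eq (D ∪ U) (a + U.card) (by omega)
  have hU : U ⊆ t := Finset.subset_union_right.trans ht
  refine ⟨t \ U, ?_, ?_, Finset.sdiff_disjoint⟩
  · intro x hx
    exact Finset.mem_sdiff.2 ⟨ht (Finset.mem_union_left _ hx), Finset.disjoint_left.1 hd hx⟩
  · rw [Finset.card_sdiff_of_subset hU]; omega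

lemma exists_fresh_domino (U : Finset Cell) : ∃ p q : Cell, q ∈ nb p ∧ p ∉ U ∧ q ∉ U := by
  obtain ⟨p, hp⟩ := Infinite.exists_notMem_finset (U ∪ U.biUnion nb)
  simp only [Finset.mem_union, Finset.mem_biUnion, not_or, not_exists, not_and] at hp
  refine ⟨p, (p.1 + 1, p.2), by simp [mem_nb], hp.1, fun h => hp.2 _ h ?_⟩
  exact nb_symm (by simp [mem_nb])

/-- Position reached when the maker follows the memoryless policy `f`. -/
def pos (f : Finset Cell → Finset Cell → Finset Cell) (l : List (Finset Cell)) :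
    Finset Cell × Finset Cell :=
  l.foldl (fun s b => (s.1 ∪ f s.1 s.2, s.2 ∪ b)) (∅, ∅)

/-- The strategy that follows the memoryless policy `f`. -/
def strat (f : Finset Cell → Finset Cell → Finset Cell) (l : List (Finset Cell)) : Finset Cell :=
  f (pos f l).1 (pos f l).2

lemma pos_eq (f : Finset Cell → Finset Cell → Finset Cell) (β : ℕ → Finset Cell) (n : ℕ) :
    pos f ((List.range n).map β) = (makerMarks (strat f) β n, breakerMarks β n) := by
  induction n with
  | zero => rfl
  | succ n ih =>
    have h2 : makerMove (strat f) β n = f (makerMarks (strat f) β n) (breakerMarks β n) := by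
      unfold makerMove strat
      rw [ih]
      rfl
    have h1 : pos f ((List.range (n + 1)).map β) =
        (fun (s : Finset Cell × Finset Cell) b => (s.1 ∪ f s.1 s.2, s.2 ∪ b))
          (pos f ((List.range n).map β)) (β n) := by
      simp [pos, List.range_succ, List.foldl_append]
    rw [h1, ih]
    simp only [makerMarks, breakerMarks, h2]

lemma move_eq (f : Finset Cell → Finset Cell → Finset Cell) (β : ℕ → Finset Cell) (n : ℕ) :
    makerMove (strat f) β n = f (makerMarks (strat f) β n) (breakerMarks β n) := by
  unfold makerMove strat
  rw [pos_eq]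
  rfl

lemma win_many (n b : ℕ) (hn : 2 ≤ n) : IsWinner P21 n b := by
  have H : ∀ U : Finset Cell, ∃ T : Finset Cell, T.card = n ∧ Disjoint T U ∧
      ∃ p ∈ T, ∃ q ∈ T, q ∈ nb p := by
    intro U
    obtain ⟨p, q, hq, hp1, hq1⟩ := exists_fresh_domino U
    obtain ⟨T, hT, hc, hd⟩ := exists_extend U {p, q} n
      (by simp [hp1, hq1]) (Finset.card_le_two.trans hn)
    exact ⟨T, hc, hd, p, hT (by simp), q, hT (by simp), hq⟩
  choose g hg1 hg2 hg3 using H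
  refine ⟨strat (fun M B => g (M ∪ B)), fun β _ => ⟨fun k => ?_, ?_⟩⟩
  · rw [move_eq]
    exact ⟨hg1 _, hg2 _⟩
  · obtain ⟨p, hp, q, hq, h⟩ := hg3 (∅ ∪ ∅)
    refine ⟨1, placement_of_nb h _ ?_ ?_⟩ <;>
    · simp only [makerMarks, move_eq, breakerMarks]
      exact Finset.mem_union_right _ ‹_›

lemma win_three : IsWinner P21 1 3 := by
  have H : ∀ M B : Finset Cell, ∃ x : Cell, x ∉ M ∪ B ∧
      ((∃ p ∈ M, ∃ q ∈ nb p, q ∉ M ∪ B) → ∃ p ∈ M, x ∈ nb p) := by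
    intro M B
    by_cases h : ∃ p ∈ M, ∃ q ∈ nb p, q ∉ M ∪ B
    · obtain ⟨p, hp, q, hq, hn⟩ := h
      exact ⟨q, hn, fun _ => ⟨p, hp, hq⟩⟩
    · obtain ⟨x, hx⟩ := Infinite.exists_notMem_finset (M ∪ B)
      exact ⟨x, hx, fun h2 => absurd h2 h⟩
  choose g hg1 hg2 using H
  refine ⟨strat (fun M B => {g M B}), fun β hβ => ⟨fun k => ?_, ?_⟩⟩
  · rw [move_eq]
    exact ⟨Finset.card_singleton _, Finset.disjoint_singleton_left.2 (hg1 _ _)⟩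
  · set σ := strat (fun M B => {g M B}) with hσ
    have hM1 : makerMarks σ β 1 = {g ∅ ∅} := by
      simp [makerMarks, hσ, move_eq, breakerMarks]
    have hB1 : breakerMarks β 1 = β 0 := by simp [breakerMarks]
    have hex : ∃ p ∈ makerMarks σ β 1, ∃ q ∈ nb p, q ∉ makerMarks σ β 1 ∪ breakerMarks β 1 := by
      rw [hM1, hB1]
      refine ⟨g ∅ ∅, by simp, ?_⟩
      have hlt : (β 0).card < (nb (g ∅ ∅)).card := by rw [nb_card, (hβ 0).1]; norm_num
      obtain ⟨q, hq, hq2⟩ := Finset.exists_mem_notMem_of_card_lt_card hlt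
      refine ⟨q, hq, ?_⟩
      simp only [Finset.mem_union, Finset.mem_singleton, not_or]
      refine ⟨?_, hq2⟩
      rintro rfl
      exact self_notMem_nb _ hq
    obtain ⟨p, hp, hx⟩ := hg2 _ _ hex
    refine ⟨2, placement_of_nb hx _ (Finset.mem_union_left _ hp) (Finset.mem_union_right _ ?_)⟩
    rw [hσ, move_eq]
    simp [hσ]

/-- Position reached when the breaker follows the memoryless policy `g` against `σ`. -/
def bpos (σ : List (Finset Cell) → Finset Cell) (g : Finset Cell → Finset Cell → Finset Cell) :
    ℕ → List (Finset Cell) × Finset Cell × Finset Cell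
  | 0 => ([], ∅, ∅)
  | n + 1 =>
    let s := bpos σ g n
    (s.1 ++ [g (s.2.1 ∪ σ s.1) s.2.2], s.2.1 ∪ σ s.1, s.2.2 ∪ g (s.2.1 ∪ σ s.1) s.2.2)

/-- The breaker's sequence of moves when following `g` against `σ`. -/
def bseq (σ : List (Finset Cell) → Finset Cell) (g : Finset Cell → Finset Cell → Finset Cell)
    (n : ℕ) : Finset Cell :=
  g ((bpos σ g n).2.1 ∪ σ (bpos σ g n).1) (bpos σ g n).2.2

lemma bpos_eq (σ : List (Finset Cell) → Finset Cell)
    (g : Finset Cell → Finset Cell → Finset Cell) (n : ℕ) :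
    bpos σ g n = ((List.range n).map (bseq σ g), makerMarks σ (bseq σ g) n,
      breakerMarks (bseq σ g) n) := by
  induction n with
  | zero => rfl
  | succ n ih =>
    have h1 : bpos σ g (n + 1) = ((bpos σ g n).1 ++ [bseq σ g n],
      (bpos σ g n).2.1 ∪ σ (bpos σ g n).1, (bpos σ g n).2.2 ∪ bseq σ g n) := rfl
    rw [h1, ih]
    simp [List.range_succ, makerMarks, breakerMarks, makerMove]

lemma bseq_eq (σ : List (Finset Cell) → Finset Cell)
    (g : Finset Cell → Finset Cell → Finset Cell) (n : ℕ) :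
    bseq σ g n = g (makerMarks σ (bseq σ g) (n + 1)) (breakerMarks (bseq σ g) n) := by
  conv_lhs => unfold bseq
  rw [bpos_eq]
  rfl

lemma lose_four : ¬ IsWinner P21 1 4 := by
  rintro ⟨σ, hσ⟩
  have H : ∀ M B : Finset Cell, ∃ T : Finset Cell, T.card = 4 ∧ Disjoint T (M ∪ B) ∧
      ((M.biUnion nb \ (M ∪ B)).card ≤ 4 → M.biUnion nb \ (M ∪ B) ⊆ T) := by
    intro M B
    by_cases h : (M.biUnion nb \ (M ∪ B)).card ≤ 4
    · obtain ⟨T, h1, h2, h3⟩ := exists_extend (M ∪ B) _ 4 Finset.sdiff_disjoint h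
      exact ⟨T, h2, h3, fun _ => h1⟩
    · obtain ⟨T, h1, h2, h3⟩ := exists_extend (M ∪ B) ∅ 4 (by simp) (by simp)
      exact ⟨T, h2, h3, fun h4 => absurd h4 h⟩
  choose g hg1 hg2 hg3 using H
  have hB : BreakerLegal 4 σ (bseq σ g) := by
    intro n
    rw [bseq_eq]
    exact ⟨hg1 _ _, hg2 _ _⟩
  obtain ⟨hM, n, P, hP, hPs⟩ := hσ _ hB
  set β := bseq σ g with hβ
  have inv : ∀ n, (∀ p ∈ makerMarks σ β n, nb p ⊆ breakerMarks β n) ∧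
      Disjoint (makerMarks σ β n) (breakerMarks β n) := by
    intro n
    induction n with
    | zero => simp [makerMarks]
    | succ n ih =>
      obtain ⟨ih1, ih2⟩ := ih
      obtain ⟨hc, hd⟩ := hM n
      obtain ⟨x, hx⟩ := Finset.card_eq_one.1 hc
      rw [hx, Finset.disjoint_singleton_left, Finset.mem_union, not_or] at hd
      have hm : makerMarks σ β (n + 1) = makerMarks σ β n ∪ {x} := by rw [← hx]; rfl
      have hb : breakerMarks β (n + 1) = breakerMarks β n ∪ β n := rfl
      have hN : ∀ p ∈ makerMarks σ β (n + 1), ∀ q ∈ nb p, q ∉ makerMarks σ β (n + 1) := by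
        intro p hp q hq hqm
        rw [hm, Finset.mem_union, Finset.mem_singleton] at hp hqm
        rcases hp with hp | rfl
        · have hqb := ih1 p hp hq
          rcases hqm with hqm | rfl
          · exact Finset.disjoint_left.1 ih2 hqm hqb
          · exact hd.2 hqb
        · rcases hqm with hqm | rfl
          · exact hd.2 (ih1 q hqm (nb_symm hq))
          · exact self_notMem_nb _ hq
      have hsub : (makerMarks σ β (n + 1)).biUnion nb \
          (makerMarks σ β (n + 1) ∪ breakerMarks β n) ⊆ nb x := by
        intro q hq
        rw [Finset.mem_sdiff, Finset.mem_biUnion, Finset.mem_union, not_or] at hq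
        obtain ⟨⟨p, hp, hq1⟩, hq2, hq3⟩ := hq
        rw [hm, Finset.mem_union, Finset.mem_singleton] at hp
        rcases hp with hp | rfl
        · exact absurd (ih1 p hp hq1) hq3
        · exact hq1
      have hT := hg3 _ _ ((Finset.card_le_card hsub).trans (nb_card x).le)
      rw [hβ, ← bseq_eq σ g n, ← hβ] at hT
      refine ⟨fun p hp q hq => ?_, ?_⟩
      · rw [hb, Finset.mem_union]
        by_cases h : q ∈ breakerMarks β n
        · exact Or.inl h
        · refine Or.inr (hT ?_)
          rw [Finset.mem_sdiff, Finset.mem_biUnion, Finset.mem_union, not_or]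
          exact ⟨⟨p, hp, hq⟩, hN p hp q hq, h⟩
      · have h3 := (hB n).2
        rw [Finset.disjoint_union_right] at h3
        rw [hb, Finset.disjoint_union_right]
        refine ⟨?_, h3.1.symm⟩
        rw [hm, Finset.disjoint_union_left, Finset.disjoint_singleton_left]
        exact ⟨ih2, hd.2⟩
  obtain ⟨p, hp, q, hq, h⟩ := nb_of_placement hP
  exact Finset.disjoint_left.1 (inv n).2 (hPs hq) ((inv n).1 p (hPs hp) h)

/-- The domino has threshold sequence `(3, ∞)`: it is a `(1,3)`-winner, a `(1,4)`-loser,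
and an `(n,b)`-winner for every `n ≥ 2` and every `b`. -/
theorem P21_threshold :
    IsWinner P21 1 3 ∧ ¬ IsWinner P21 1 4 ∧
    ∀ n b : ℕ, 2 ≤ n → IsWinner P21 n b := by
  exact ⟨win_three, lose_four, fun n b hn => win_many n b hn⟩
end
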